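/- arXiv:2305.05518 — 2 statements merged into one kernel-verified Lean document; each statement's English description precedes it below -/
import Mathlib

section
/- Let L ≥ 2 and let t_1, …, t_K ∈ {0,1}^L be output reference points that cover {0,1}^L. Suppose there exists y′ ∈ {0,1}^L such that δ̂_k = ‖y′ − t_k‖ for every k ∈ {1, …, K}. Then for every index kₒ minimizing δ̂_k over k ∈ {1, …, K}, the NN-MLM prediction satisfies t_{kₒ} = y′, and t_{kₒ} is a minimizer of the multilateration loss J over {0,1}^L. (Theorem 1, Part 2: if the distance estimates are exact for some label assignment, NN-MLM returns an optimal solution to the multilateration problem.) -/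
/-- Theorem 1, Part 2: if the distance estimates are exact for some label
assignment, NN-MLM returns an optimal solution to the multilateration problem. -/
theorem nnmlm_optimal_for_exact_estimates
    (L K : ℕ) (hL : 2 ≤ L)
    (t : Fin K → EuclideanSpace ℝ (Fin L)) (δ : Fin K → ℝ)
    (y' : EuclideanSpace ℝ (Fin L))
    (ht : ∀ k j, t k j = 0 ∨ t k j = 1)
    (hcover : ∀ y : EuclideanSpace ℝ (Fin L), (∀ j, y j = 0 ∨ y j = 1) → ∃ k, t k = y)
    (hy' : ∀ j, y' j = 0 ∨ y' j = 1)
    (hδ : ∀ k, δ k = ‖y' - t k‖) :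
    ∀ k₀ : Fin K, (∀ k, δ k₀ ≤ δ k) →
      t k₀ = y' ∧
      ∀ y : EuclideanSpace ℝ (Fin L), (∀ j, y j = 0 ∨ y j = 1) →
        (∑ k, (‖t k₀ - t k‖ ^ 2 - (δ k) ^ 2) ^ 2) ≤
          (∑ k, (‖y - t k‖ ^ 2 - (δ k) ^ 2) ^ 2) := by
  intro k₀ hk₀
  have h : t k₀ = y' := by
    obtain ⟨k, hk⟩ := hcover y' hy'
    have h1 := hk₀ k
    rw [hδ k₀, hδ k, hk, sub_self, norm_zero] at h1
    exact (sub_eq_zero.mp (norm_le_zero_iff.mp h1)).symm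
  refine ⟨h, fun y _ => Finset.sum_le_sum fun k _ => ?_⟩
  have h0 : (‖t k₀ - t k‖ ^ 2 - (δ k) ^ 2) ^ 2 = 0 := by
    rw [h, hδ k]
    ring
  rw [h0]
  exact sq_nonneg _
end

section
/- Let t_1, …, t_K ∈ {0,1}^L be output reference points that cover {0,1}^L, and suppose δ̂_k = ‖y′ − t_k‖ for every k ∈ {1, …, K}, for some y′ ∈ {0,1}^L. Then y′ is the unique minimizer of the multilateration loss J over {0,1}^L: J(y′) = 0 and J(y) > 0 for every y ∈ {0,1}^L with y ≠ y′. (Uniqueness of the optimal multilateration solution under exact distance estimates, following the proof of Theorem 1, Part 2: J(y) = 0 forces ‖y − t_k‖ = ‖y′ − t_k‖ for all k, and taking a reference point equal to y yields y = y′.) -/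
/-- Uniqueness of the optimal multilateration solution under exact distance
estimates: `y'` is the unique minimizer of the loss over `{0,1}^L`. -/
theorem exact_estimates_unique_minimizer
    (L K : ℕ)
    (t : Fin K → EuclideanSpace ℝ (Fin L)) (δ : Fin K → ℝ)
    (y' : EuclideanSpace ℝ (Fin L))
    (ht : ∀ k j, t k j = 0 ∨ t k j = 1)
    (hcover : ∀ y : EuclideanSpace ℝ (Fin L), (∀ j, y j = 0 ∨ y j = 1) → ∃ k, t k = y)
    (hy' : ∀ j, y' j = 0 ∨ y' j = 1)
    (hδ : ∀ k, δ k = ‖y' - t k‖) :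
    (∑ k, (‖y' - t k‖ ^ 2 - (δ k) ^ 2) ^ 2) = 0 ∧
    ∀ y : EuclideanSpace ℝ (Fin L), (∀ j, y j = 0 ∨ y j = 1) → y ≠ y' →
      0 < ∑ k, (‖y - t k‖ ^ 2 - (δ k) ^ 2) ^ 2 := by
  refine ⟨Finset.sum_eq_zero fun k _ => by rw [hδ k]; ring, fun y hy hne => ?_⟩
  obtain ⟨k, hk⟩ := hcover y hy
  refine Finset.sum_pos' (fun i _ => sq_nonneg _) ⟨k, Finset.mem_univ k, ?_⟩
  have hpos : 0 < ‖y' - y‖ := norm_pos_iff.mpr (sub_ne_zero.mpr hne.symm)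
  rw [hδ k, hk, sub_self, norm_zero]
  have h2 : (0 : ℝ) ^ 2 - ‖y' - y‖ ^ 2 ≠ 0 := by
    have := pow_pos hpos 2
    intro h
    linarith
  exact lt_of_le_of_ne (sq_nonneg _) (pow_ne_zero 2 h2).symm
end
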